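/- Let ε > 0, μ > 0 and s ∈ (0,1). Then for every real-valued Schwartz function w on ℝ², Re ∫_{ℝ²} |ξ|^{2s} 𝓕( (1/ε) Δw + μ x·∇w )(ξ) · conj(𝓕w(ξ)) dξ = −(1/ε) ‖w‖²_{Ḣ^{1+s}} − μ(1−s) ‖w‖²_{Ḣ^s}. -/

import Mathlib

open MeasureTheory Real Set
open scoped InnerProductSpace

noncomputable section

abbrev R2 : Type := EuclideanSpace ℝ (Fin 2)

/-- Japanese bracket `⟨x⟩ = (1+|x|²)^{1/2}`. -/
def jap (x : R2) : ℝ := Real.sqrt (1 + ‖x‖ ^ 2)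

/-- `∇κ(z) = −(1/(2π)) z/|z|²`, the gradient of the Laplace kernel in the plane. -/
def gradKappa (z : R2) : R2 := (-(1 / (2 * π)) * (‖z‖ ^ 2)⁻¹) • z

/-- The (vector valued) convolution `(∇κ⋆g)(x)`. -/
def gradKappaConv (g : R2 → ℝ) (x : R2) : R2 := ∫ y, g y • gradKappa (x - y)

/-- The scalar function `∇κ⋆F = Σ_j ∂_jκ ⋆ F_j` for a vector field `F`. -/
def gradKappaConvVec (F : R2 → R2) (x : R2) : ℝ := ∫ y, ⟪gradKappa (x - y), F y⟫_ℝ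

/-- Fourier transform with the convention `𝓕f(ξ) = ∫ f(x) e^{−i x·ξ} dx`. -/
def FT (f : R2 → ℂ) (ξ : R2) : ℂ := ∫ x, f x * Complex.exp (-Complex.I * ((⟪x, ξ⟫_ℝ : ℝ) : ℂ))

def FTr (f : R2 → ℝ) : R2 → ℂ := FT fun x => (f x : ℂ)

/-- Homogeneous Sobolev seminorm `‖f‖_{Ḣ^σ} = ‖ |ξ|^σ 𝓕f ‖_{L²}`. -/
def sobNorm (σ : ℝ) (f : R2 → ℝ) : ℝ :=
  (∫ ξ : R2, ‖ξ‖ ^ (2 * σ) * ‖FTr f ξ‖ ^ 2) ^ (1/2 : ℝ)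

def L2Norm (f : R2 → ℝ) : ℝ := (∫ x : R2, f x ^ 2) ^ (1/2 : ℝ)

def L1Norm (f : R2 → ℝ) : ℝ := ∫ x : R2, |f x|

/-- Weighted norm `‖f‖_{L²_k} = ‖⟨x⟩^k f‖_{L²}`. -/
def L2kNorm (k : ℝ) (f : R2 → ℝ) : ℝ := (∫ x : R2, jap x ^ (2 * k) * f x ^ 2) ^ (1/2 : ℝ)

def gradL2kNorm (k : ℝ) (f : R2 → ℝ) : ℝ :=
  (∫ x : R2, jap x ^ (2 * k) * ‖gradient f x‖ ^ 2) ^ (1/2 : ℝ)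

def H1kNorm (k : ℝ) (f : R2 → ℝ) : ℝ := (L2kNorm k f ^ 2 + gradL2kNorm k f ^ 2) ^ (1/2 : ℝ)

def gradL2Norm (f : R2 → ℝ) : ℝ := (∫ x : R2, ‖gradient f x‖ ^ 2) ^ (1/2 : ℝ)

/-- Weighted pairing `⟨f,g⟩_{L²_k} = ∫ f g ⟨x⟩^{2k}`. -/
def L2kInner (k : ℝ) (f g : R2 → ℝ) : ℝ := ∫ x : R2, f x * g x * jap x ^ (2 * k)

/-- Dual norm `‖φ‖_{H^{-1}_k} = sup { ⟨φ,f⟩_{L²_k} : ‖f‖_{H¹_k} ≤ 1 }`. -/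
def Hm1kNorm (k : ℝ) (φ : R2 → ℝ) : ℝ :=
  sSup {r | ∃ f : R2 → ℝ, H1kNorm k f ≤ 1 ∧ r = L2kInner k φ f}

def basis2 (i : Fin 2) : R2 := EuclideanSpace.single i 1

/-- Partial derivative in the `i`-th coordinate direction. -/
def pd (i : Fin 2) (f : R2 → ℝ) (x : R2) : ℝ := fderiv ℝ f x (basis2 i)

/-- Laplacian. -/
def lap (f : R2 → ℝ) (x : R2) : ℝ := ∑ i, pd i (pd i f) x

/-- Divergence of a vector field. -/
def divg (F : R2 → R2) (x : R2) : ℝ := ∑ i, pd i (fun y => F y i) x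

/-- `|∇²f|² = Σ_{i,j} (∂_i∂_j f)²`. -/
def hessSq (f : R2 → ℝ) (x : R2) : ℝ := ∑ i, ∑ j, pd i (pd j f) x ^ 2

open scoped FourierTransform LineDeriv SchwartzMap

/-- Dilation by `(2π)⁻¹`. -/
def dil : R2 ≃L[ℝ] R2 :=
  ContinuousLinearEquiv.smulLeft (Units.mk0 ((2 * π)⁻¹ : ℝ) (by positivity))

lemma dil_apply (x : R2) : dil x = (2 * π)⁻¹ • x := rfl

/-- The Fourier transform as a Schwartz function. -/
def ft (f : 𝓢(R2, ℂ)) : 𝓢(R2, ℂ) :=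
  SchwartzMap.compCLMOfContinuousLinearEquiv ℂ dil (𝓕 f)

lemma ft_apply (f : 𝓢(R2, ℂ)) (ξ : R2) : ft f ξ = (𝓕 f) (dil ξ) := rfl

/-- Multiplication by a coordinate. -/
def mulX (m : R2) (f : 𝓢(R2, ℂ)) : 𝓢(R2, ℂ) := SchwartzMap.smulLeftCLM ℂ (inner ℝ · m) f

lemma tg_inner (m : R2) : (fun x : R2 => inner ℝ x m).HasTemperateGrowth :=
  ((innerSL ℝ).flip m).hasTemperateGrowth

lemma mulX_apply (m : R2) (f : 𝓢(R2, ℂ)) (x : R2) :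
    mulX m f x = ((inner ℝ x m : ℝ) : ℂ) * f x := by
  simp [mulX, tg_inner m]

lemma FT_eq (f : 𝓢(R2, ℂ)) : FT f = ft f := by
  ext ξ
  rw [ft_apply, SchwartzMap.fourier_coe, Real.fourier_eq', FT]
  refine integral_congr_ae (Filter.Eventually.of_forall fun x => ?_)
  simp only [dil_apply, inner_smul_right, smul_eq_mul]
  rw [mul_comm]
  congr 2
  have : (π : ℂ) ≠ 0 := by exact_mod_cast Real.pi_ne_zero
  push_cast
  field_simp

lemma ft_deriv (m : R2) (f : 𝓢(R2, ℂ)) (ξ : R2) :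
    ft (∂_{m} f) ξ = Complex.I * ((inner ℝ ξ m : ℝ) : ℂ) * ft f ξ := by
  rw [ft_apply, SchwartzMap.fourier_lineDerivOp_eq, ft_apply]
  have : (π : ℂ) ≠ 0 := by exact_mod_cast Real.pi_ne_zero
  simp only [smul_apply, SchwartzMap.smulLeftCLM_apply_apply (tg_inner m), dil_apply,
    real_inner_smul_left, smul_eq_mul, Complex.real_smul]
  push_cast
  field_simp

lemma ft_mul (m : R2) (f : 𝓢(R2, ℂ)) (ξ : R2) :
    ft (mulX m f) ξ = Complex.I * (∂_{m} (ft f)) ξ := by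
  have : (π : ℂ) ≠ 0 := by exact_mod_cast Real.pi_ne_zero
  have h : ∂_{m} (ft f) = SchwartzMap.compCLMOfContinuousLinearEquiv ℂ dil (∂_{dil m} (𝓕 f)) :=
    SchwartzMap.lineDerivOp_compCLMOfContinuousLinearEquiv ℂ m dil (𝓕 f)
  have h2 : ∂_{dil m} (𝓕 f) = (2 * π)⁻¹ • 𝓕 (-(2 * π * Complex.I) • mulX m f) := by
    rw [dil_apply, LineDeriv.lineDerivOp_left_smul, SchwartzMap.lineDerivOp_fourier_eq]; rfl
  rw [h, h2, FourierTransform.fourier_smul]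
  simp only [SchwartzMap.compCLMOfContinuousLinearEquiv_apply, Function.comp,
    smul_apply, Complex.real_smul, smul_eq_mul, ft_apply]
  push_cast
  field_simp
  linear_combination (𝓕 (mulX m f)) (dil ξ) * Complex.I_sq

/-- The product `f · conj g`. -/
def mulConj (f g : 𝓢(R2, ℂ)) : 𝓢(R2, ℂ) :=
  SchwartzMap.bilinLeftCLM (ContinuousLinearMap.mul ℝ ℂ)
    (SchwartzMap.postcompCLM (𝕜 := ℝ) (Complex.conjCLE : ℂ →L[ℝ] ℂ) g).hasTemperateGrowth f

lemma mulConj_apply (f g : 𝓢(R2, ℂ)) (x : R2) :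
    mulConj f g x = f x * (starRingEnd ℂ) (g x) := by
  simp [mulConj]

def nsq (g : 𝓢(R2, ℂ)) : 𝓢(R2, ℝ) :=
  SchwartzMap.postcompCLM (𝕜 := ℝ) Complex.reCLM (mulConj g g)

lemma nsq_apply (g : 𝓢(R2, ℂ)) (x : R2) : nsq g x = ‖g x‖ ^ 2 := by
  simp only [nsq, SchwartzMap.postcompCLM_apply, mulConj_apply, Complex.mul_conj, Complex.normSq_eq_norm_sq]
  rfl

lemma nsq_deriv (g : 𝓢(R2, ℂ)) (m x : R2) :
    (∂_{m} (nsq g)) x = 2 * ((∂_{m} g) x * (starRingEnd ℂ) (g x)).re := by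
  rw [SchwartzMap.lineDerivOp_apply_eq_fderiv, SchwartzMap.lineDerivOp_apply_eq_fderiv]
  have h : (nsq g : R2 → ℝ) = fun x => ‖g x‖ ^ 2 := funext (nsq_apply g)
  rw [h, ((g.hasFDerivAt x).norm_sq).fderiv]
  simp
  ring

lemma rpow_bd {s : ℝ} (hs : s ∈ Set.Ioo (0:ℝ) 1) {t : ℝ} (ht : 0 ≤ t) :
    t ^ (2 * s) ≤ 1 + t ^ 2 := by
  obtain ⟨h0, h1⟩ := hs
  rcases le_total t 1 with h | h
  · have := Real.rpow_le_one ht h (by linarith : 0 ≤ 2 * s)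
    nlinarith [sq_nonneg t]
  · have : t ^ (2 * s) ≤ t ^ (2:ℝ) := Real.rpow_le_rpow_of_exponent_le h (by linarith)
    rw [Real.rpow_two] at this
    linarith

lemma integ_of_le {E : Type*} [NormedAddCommGroup E] [NormedSpace ℝ E] (F : 𝓢(R2, E))
    {s : ℝ} (hs : s ∈ Set.Ioo (0:ℝ) 1) {P : R2 → ℝ} (hP : Measurable P) {C : ℝ}
    (hb : ∀ x, |P x| ≤ C * ‖x‖ ^ (2 * s)) : Integrable (fun x => P x • F x) := by
  have h1 := ((F.integrable_pow_mul volume 0).add (F.integrable_pow_mul volume 2)).const_mul |C|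
  refine h1.mono (hP.aestronglyMeasurable.smul F.continuous.aestronglyMeasurable)
    (Filter.Eventually.of_forall fun x => ?_)
  rw [norm_smul]
  refine le_trans ?_ (le_abs_self _)
  simp only [Pi.add_apply, pow_zero, one_mul]
  have h2 := rpow_bd hs (norm_nonneg x)
  have h3 := hb x
  have h4 : C * ‖x‖ ^ (2 * s) ≤ |C| * (1 + ‖x‖ ^ 2) := by
    gcongr
    exact le_abs_self C
  have h5 : ‖P x‖ ≤ |C| * (1 + ‖x‖ ^ 2) := h3.trans h4
  calc ‖P x‖ * ‖F x‖ ≤ (|C| * (1 + ‖x‖ ^ 2)) * ‖F x‖ := by gcongr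
    _ = _ := by ring

lemma integ_w {E : Type*} [NormedAddCommGroup E] [NormedSpace ℝ E] (F : 𝓢(R2, E))
    {s : ℝ} (hs : s ∈ Set.Ioo (0:ℝ) 1) : Integrable (fun x => (‖x‖ ^ (2 * s)) • F x) :=
  integ_of_le F hs (C := 1) (by fun_prop) fun x => by
    rw [one_mul, abs_of_nonneg (by positivity)]

/-- derivative of the weight -/
def wd (s : ℝ) (m x : R2) : ℝ :=
  ‖x‖ ^ (2 * s) * ‖m‖ ^ 2 + 2 * s * (‖x‖ ^ 2) ^ (s - 1) * inner ℝ x m ^ 2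

lemma hasLineDeriv_w {s : ℝ} (hs : s ∈ Set.Ioo (0:ℝ) 1) (m x : R2) :
    HasLineDerivAt ℝ (fun x : R2 => ‖x‖ ^ (2 * s) * inner ℝ x m) (wd s m x) x m := by
  obtain ⟨h0, h1⟩ := hs
  have hi : HasFDerivAt (fun x : R2 => inner ℝ x m) ((innerSL ℝ).flip m) x :=
    ((innerSL ℝ).flip m).hasFDerivAt
  rcases eq_or_ne x 0 with rfl | hx
  · unfold HasLineDerivAt
    have e : wd s m 0 = 0 := by
      simp [wd, Real.zero_rpow (by linarith : 2 * s ≠ 0)]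
    rw [e]
    have h6 : (fun t : ℝ => (fun x : R2 => ‖x‖ ^ (2 * s) * inner ℝ x m) ((0 : R2) + t • m)) =
        fun t : ℝ => (‖m‖ ^ (2 * s) * ‖m‖ ^ 2) * (|t| ^ (2 * s) * t) := by
      ext t
      simp only []
      rw [zero_add, norm_smul, real_inner_smul_left, real_inner_self_eq_norm_sq,
        Real.mul_rpow (norm_nonneg _) (norm_nonneg _), Real.norm_eq_abs]
      ring
    rw [h6]
    rw [hasDerivAt_iff_tendsto_slope_zero]
    have hc : Continuous (fun t : ℝ => (‖m‖ ^ (2 * s) * ‖m‖ ^ 2) * |t| ^ (2 * s)) :=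
      continuous_const.mul (continuous_abs.rpow_const fun _ => Or.inr (by linarith))
    have ht := (hc.tendsto 0).mono_left (nhdsWithin_le_nhds (s := {0}ᶜ))
    simp only [abs_zero, Real.zero_rpow (by linarith : 2 * s ≠ 0), mul_zero] at ht
    refine ht.congr' ?_
    filter_upwards [self_mem_nhdsWithin] with t h
    have h : t ≠ 0 := h
    simp only [zero_add, smul_eq_mul, mul_zero, sub_zero]
    field_simp
  · have hn : ‖x‖ ^ 2 ≠ 0 := by simpa using hx
    have h2 := ((hasStrictFDerivAt_norm_sq x).hasFDerivAt.rpow_const (p := s) (Or.inl hn)).mul hi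
    have h3 := h2.hasLineDerivAt m
    have e : (fun x : R2 => ‖x‖ ^ (2 * s) * inner ℝ x m) =
        (fun x : R2 => (‖x‖ ^ 2) ^ s * inner ℝ x m) := by
      ext y
      rw [Real.rpow_mul (norm_nonneg y), Real.rpow_two]
    rw [e]
    have e' : wd s m x = ((‖x‖ ^ 2) ^ s • (innerSL ℝ).flip m +
        (inner ℝ x m : ℝ) • (s * (‖x‖ ^ 2) ^ (s - 1)) • 2 • (innerSL ℝ) x) m := by
      rw [wd, Real.rpow_mul (norm_nonneg x), Real.rpow_two, ← real_inner_self_eq_norm_sq m]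
      simp only [add_apply, smul_apply,
        ContinuousLinearMap.flip_apply, innerSL_apply_apply, smul_eq_mul, nsmul_eq_mul]
      have hx2 : (innerSL ℝ x) m = inner ℝ x m := rfl
      rw [hx2]
      push_cast
      ring
    rw [e']
    exact h3

lemma norm_basis2 (j : Fin 2) : ‖basis2 j‖ = 1 := by simp [basis2]

lemma inner_basis2 (x : R2) (j : Fin 2) : inner ℝ x (basis2 j) = x j := by
  rw [basis2, EuclideanSpace.inner_single_right]
  simp

lemma rpow_aux {s : ℝ} (hs : s ∈ Set.Ioo (0:ℝ) 1) (x : R2) :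
    (‖x‖ ^ 2) ^ (s - 1) * ‖x‖ ^ 2 = ‖x‖ ^ (2 * s) := by
  obtain ⟨h0, h1⟩ := hs
  rcases eq_or_ne x 0 with rfl | hx
  · simp [Real.zero_rpow (by linarith : 2 * s ≠ 0)]
  · have hn : ‖x‖ ^ 2 ≠ 0 := by simpa using hx
    rw [Real.rpow_mul (norm_nonneg x), Real.rpow_two, ← Real.rpow_add_one hn]
    simp

lemma wd_sum {s : ℝ} (hs : s ∈ Set.Ioo (0:ℝ) 1) (x : R2) :
    wd s (basis2 0) x + wd s (basis2 1) x = (2 + 2 * s) * ‖x‖ ^ (2 * s) := by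
  have h := rpow_aux hs x
  have h2 : ‖x‖ ^ 2 = x 0 ^ 2 + x 1 ^ 2 := by
    rw [EuclideanSpace.norm_sq_eq]; simp
  simp only [wd, norm_basis2, inner_basis2]
  linear_combination 2 * s * h - 2 * s * (‖x‖ ^ 2) ^ (s - 1) * h2

lemma ibp {s : ℝ} (hs : s ∈ Set.Ioo (0:ℝ) 1) (h : 𝓢(R2, ℝ)) (j : Fin 2) :
    Integrable (fun x : R2 => wd s (basis2 j) x * h x) ∧
    Integrable (fun x : R2 => ‖x‖ ^ (2 * s) * inner ℝ x (basis2 j) * (∂_{basis2 j} h) x) ∧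
    ∫ x : R2, ‖x‖ ^ (2 * s) * inner ℝ x (basis2 j) * (∂_{basis2 j} h) x =
      - ∫ x : R2, wd s (basis2 j) x * h x := by
  set m := basis2 j with hm
  have hm1 : ‖m‖ = 1 := norm_basis2 j
  have h0 := hs.1
  have i1 : Integrable (fun x : R2 => wd s m x * h x) := by
    refine integ_of_le h hs (C := 1 + 2 * s) (by unfold wd; fun_prop) fun x => ?_
    have hw : 0 ≤ wd s m x := by unfold wd; positivity
    rw [abs_of_nonneg hw]
    unfold wd
    rw [hm1]
    have h1 : inner ℝ x m ^ 2 ≤ ‖x‖ ^ 2 := by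
      have := abs_real_inner_le_norm x m
      rw [hm1, mul_one] at this
      exact sq_le_sq.mpr (by rwa [abs_norm])
    have h2 : 2 * s * (‖x‖ ^ 2) ^ (s - 1) * inner ℝ x m ^ 2 ≤
        2 * s * (‖x‖ ^ 2) ^ (s - 1) * ‖x‖ ^ 2 := by gcongr
    have h3 := rpow_aux hs x
    nlinarith
  have key : ∀ F : 𝓢(R2, ℝ),
      Integrable (fun x : R2 => ‖x‖ ^ (2 * s) * inner ℝ x m * F x) := fun F => by
    have := integ_w (SchwartzMap.smulLeftCLM ℝ (inner ℝ · m) F) hs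
    simpa [tg_inner m, mul_assoc] using this
  refine ⟨i1, key _, ?_⟩
  exact integral_bilinear_hasLineDerivAt_right_eq_neg_left_of_integrable
    (B := ContinuousLinearMap.mul ℝ ℝ) (v := m)
    (f := fun x : R2 => ‖x‖ ^ (2 * s) * inner ℝ x m) (f' := wd s m)
    (g := h) (g' := (∂_{m} h : 𝓢(R2, ℝ))) i1 (key _) (key _)
    (fun x _ => hasLineDeriv_w hs m x)
    (fun x _ => by
      rw [SchwartzMap.lineDerivOp_apply_eq_fderiv]
      exact (h.hasFDerivAt x).hasLineDerivAt m)

/-- complexification -/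
def cx (w : 𝓢(R2, ℝ)) : 𝓢(R2, ℂ) := SchwartzMap.postcompCLM (𝕜 := ℝ) Complex.ofRealCLM w

lemma cx_apply (w : 𝓢(R2, ℝ)) (x : R2) : cx w x = (w x : ℂ) := rfl

lemma cx_deriv (w : 𝓢(R2, ℝ)) (m : R2) : ∂_{m} (cx w) = cx (∂_{m} w) := by
  ext x
  rw [SchwartzMap.lineDerivOp_apply_eq_fderiv, cx_apply,
    SchwartzMap.lineDerivOp_apply_eq_fderiv]
  have h : HasFDerivAt (cx w) (Complex.ofRealCLM.comp (fderiv ℝ w x)) x :=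
    Complex.ofRealCLM.hasFDerivAt.comp x (w.hasFDerivAt x)
  rw [h.fderiv]
  simp

lemma pd_eq (w : 𝓢(R2, ℝ)) (j : Fin 2) : pd j w = (∂_{basis2 j} w : 𝓢(R2, ℝ)) := by
  ext x
  rw [SchwartzMap.lineDerivOp_apply_eq_fderiv, pd]

lemma lap_eq (w : 𝓢(R2, ℝ)) (x : R2) :
    lap w x = (∂_{basis2 0} (∂_{basis2 0} w) : 𝓢(R2, ℝ)) x
      + (∂_{basis2 1} (∂_{basis2 1} w) : 𝓢(R2, ℝ)) x := by
  simp [lap, pd_eq]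

lemma inner_grad_eq (w : 𝓢(R2, ℝ)) (x : R2) :
    inner ℝ x (gradient w x) = inner ℝ x (basis2 0) * (∂_{basis2 0} w : 𝓢(R2, ℝ)) x
      + inner ℝ x (basis2 1) * (∂_{basis2 1} w : 𝓢(R2, ℝ)) x := by
  rw [real_inner_comm, gradient, InnerProductSpace.toDual_symm_apply,
    SchwartzMap.lineDerivOp_apply_eq_fderiv, SchwartzMap.lineDerivOp_apply_eq_fderiv,
    inner_basis2, inner_basis2, ← smul_eq_mul, ← smul_eq_mul, ← map_smul, ← map_smul, ← map_add]
  congr 1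
  ext i
  fin_cases i <;> simp [basis2]

/-- the Schwartz function whose transform appears in the statement -/
def opA (ε μ : ℝ) (f : 𝓢(R2, ℂ)) : 𝓢(R2, ℂ) :=
  ((1 / ε : ℝ) : ℂ) • (∂_{basis2 0} (∂_{basis2 0} f) + ∂_{basis2 1} (∂_{basis2 1} f)) +
    (μ : ℂ) • (mulX (basis2 0) (∂_{basis2 0} f) + mulX (basis2 1) (∂_{basis2 1} f))

lemma opA_eq (ε μ : ℝ) (w : 𝓢(R2, ℝ)) :
    (fun x => (((1 / ε) * lap w x + μ * inner ℝ x (gradient w x) : ℝ) : ℂ)) =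
      opA ε μ (cx w) := by
  ext x
  rw [lap_eq, inner_grad_eq]
  simp only [opA, cx_deriv, add_apply, smul_apply, mulX_apply, cx_apply, smul_eq_mul]
  push_cast
  ring

lemma ft_add (f g : 𝓢(R2, ℂ)) (ξ : R2) : ft (f + g) ξ = ft f ξ + ft g ξ := by
  simp [ft_apply, FourierTransform.fourier_add]

lemma ft_smul (c : ℂ) (f : 𝓢(R2, ℂ)) (ξ : R2) : ft (c • f) ξ = c * ft f ξ := by
  simp [ft_apply, FourierTransform.fourier_smul]

lemma ft_xd (f : 𝓢(R2, ℂ)) (j : Fin 2) (ξ : R2) :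
    ft (mulX (basis2 j) (∂_{basis2 j} f)) ξ =
      - ft f ξ - ((inner ℝ ξ (basis2 j) : ℝ) : ℂ) * (∂_{basis2 j} (ft f)) ξ := by
  rw [ft_mul, SchwartzMap.lineDerivOp_apply_eq_fderiv]
  have h : (ft (∂_{basis2 j} f) : R2 → ℂ) =
      fun ξ => Complex.I * ((inner ℝ ξ (basis2 j) : ℝ) : ℂ) * ft f ξ := funext (ft_deriv _ f)
  have hi : HasFDerivAt (fun ξ : R2 => ((inner ℝ ξ (basis2 j) : ℝ) : ℂ))
      (Complex.ofRealCLM.comp ((innerSL ℝ).flip (basis2 j))) ξ :=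
    (Complex.ofRealCLM.comp ((innerSL ℝ).flip (basis2 j))).hasFDerivAt
  have h2 := (hi.const_mul Complex.I).mul ((ft f).hasFDerivAt ξ)
  rw [h]
  have h3 := h2.fderiv
  simp only [Pi.mul_def] at h3
  rw [h3, SchwartzMap.lineDerivOp_apply_eq_fderiv]
  have hb : (inner ℝ (basis2 j) (basis2 j) : ℝ) = 1 := by
    rw [real_inner_self_eq_norm_sq, norm_basis2]; norm_num
  simp only [add_apply, smul_apply,
    ContinuousLinearMap.comp_apply, ContinuousLinearMap.flip_apply, innerSL_apply_apply,
    smul_eq_mul, hb, Complex.ofRealCLM_apply, Complex.ofReal_one]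
  linear_combination (ft f ξ + ((inner ℝ ξ (basis2 j) : ℝ) : ℂ) * (fderiv ℝ (ft f) ξ) (basis2 j)) * Complex.I_sq

lemma ft_opA (ε μ : ℝ) (f : 𝓢(R2, ℂ)) (ξ : R2) :
    ft (opA ε μ f) ξ = -((1 / ε : ℝ) : ℂ) * ((‖ξ‖ ^ 2 : ℝ) : ℂ) * ft f ξ
      + (μ : ℂ) * (-2 * ft f ξ - ((inner ℝ ξ (basis2 0) : ℝ) : ℂ) * (∂_{basis2 0} (ft f)) ξ
        - ((inner ℝ ξ (basis2 1) : ℝ) : ℂ) * (∂_{basis2 1} (ft f)) ξ) := by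
  have h2 : ‖ξ‖ ^ 2 = inner ℝ ξ (basis2 0) ^ 2 + inner ℝ ξ (basis2 1) ^ 2 := by
    rw [EuclideanSpace.norm_sq_eq, inner_basis2, inner_basis2]; simp
  rw [h2]
  simp only [opA, ft_add, ft_smul, ft_xd, ft_deriv]
  push_cast
  linear_combination ((1 / ε : ℂ) * ft f ξ * (((inner ℝ ξ (basis2 0) : ℝ) : ℂ) ^ 2 +
    ((inner ℝ ξ (basis2 1) : ℝ) : ℂ) ^ 2)) * Complex.I_sq

lemma sobNorm_sq (σ : ℝ) (w : 𝓢(R2, ℝ)) :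
    sobNorm σ w ^ 2 = ∫ ξ : R2, ‖ξ‖ ^ (2 * σ) * nsq (ft (cx w)) ξ := by
  have h : FTr w = ft (cx w) := FT_eq (cx w)
  unfold sobNorm
  rw [h, ← Real.sqrt_eq_rpow, Real.sq_sqrt (integral_nonneg fun _ => by positivity)]
  simp only [nsq_apply]

lemma pow_split {s : ℝ} (hs : s ∈ Set.Ioo (0:ℝ) 1) (ξ : R2) :
    ‖ξ‖ ^ (2 * (1 + s)) = ‖ξ‖ ^ (2 * s) * ‖ξ‖ ^ 2 := by
  rw [mul_add, add_comm, Real.rpow_add_of_nonneg (norm_nonneg _) (by linarith [hs.1]) (by norm_num)]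
  norm_num

/-- the `Ḣ^s` pairing of `(1/ε)Δw + μ x·∇w` with `w` equals
`−(1/ε)‖w‖²_{Ḣ^{1+s}} − μ(1−s)‖w‖²_{Ḣ^s}` for real-valued Schwartz `w`. -/
theorem stmt13 (ε μ s : ℝ) (hε : 0 < ε) (hμ : 0 < μ) (hs : s ∈ Set.Ioo (0:ℝ) 1) :
    ∀ w : SchwartzMap R2 ℝ,
      (∫ ξ : R2,
          ((‖ξ‖ ^ (2 * s) : ℝ) : ℂ) *
            FTr (fun x => (1 / ε) * lap (⇑w) x + μ * ⟪x, gradient (⇑w) x⟫_ℝ) ξ *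
              (starRingEnd ℂ) (FTr (⇑w) ξ)).re =
        -(1 / ε) * sobNorm (1 + s) (⇑w) ^ 2 - μ * (1 - s) * sobNorm s (⇑w) ^ 2 := by
  intro w
  set g := ft (cx w) with hg
  have e1 : FTr (fun x => (1 / ε) * lap (⇑w) x + μ * ⟪x, gradient (⇑w) x⟫_ℝ) =
      ft (opA ε μ (cx w)) := by
    unfold FTr
    rw [opA_eq, FT_eq]
  have e2 : FTr w = g := FT_eq (cx w)
  rw [e1, e2, sobNorm_sq, sobNorm_sq, ← hg]
  obtain ⟨a0, b0, c0⟩ := ibp hs (nsq g) 0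
  obtain ⟨a1, b1, c1⟩ := ibp hs (nsq g) 1
  have hI : Integrable (fun ξ : R2 => ((‖ξ‖ ^ (2 * s) : ℝ) : ℂ) * ft (opA ε μ (cx w)) ξ *
      (starRingEnd ℂ) (g ξ)) := by
    simpa [mulConj_apply, mul_assoc] using integ_w (mulConj (ft (opA ε μ (cx w))) g) hs
  have hJ : Integrable (fun ξ : R2 => ‖ξ‖ ^ (2 * s) * nsq g ξ) := integ_w (nsq g) hs
  have hK : Integrable (fun ξ : R2 => ‖ξ‖ ^ (2 * (1 + s)) * nsq g ξ) := by
    have h1 := integ_w (nsq (mulX (basis2 0) g)) hs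
    have h2 := integ_w (nsq (mulX (basis2 1) g)) hs
    refine (h1.add h2).congr (Filter.Eventually.of_forall fun ξ => ?_)
    have h2 : ‖ξ‖ ^ 2 = inner ℝ ξ (basis2 0) ^ 2 + inner ℝ ξ (basis2 1) ^ 2 := by
      rw [EuclideanSpace.norm_sq_eq, inner_basis2, inner_basis2]; simp
    simp only [Pi.add_apply, nsq_apply, mulX_apply, norm_mul, Complex.norm_real, smul_eq_mul,
      Real.norm_eq_abs, mul_pow, sq_abs]
    rw [pow_split hs, h2]
    ring
  have hre := integral_re hI
  simp only [RCLike.re_to_complex] at hre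
  rw [← hre]
  have e3 : ∀ ξ : R2, (((‖ξ‖ ^ (2 * s) : ℝ) : ℂ) * ft (opA ε μ (cx w)) ξ *
      (starRingEnd ℂ) (g ξ)).re = -(1 / ε) * (‖ξ‖ ^ (2 * (1 + s)) * nsq g ξ)
        + -(2 * μ) * (‖ξ‖ ^ (2 * s) * nsq g ξ)
        + -(μ / 2) * (‖ξ‖ ^ (2 * s) * inner ℝ ξ (basis2 0) * (∂_{basis2 0} (nsq g)) ξ
          + ‖ξ‖ ^ (2 * s) * inner ℝ ξ (basis2 1) * (∂_{basis2 1} (nsq g)) ξ) := by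
    intro ξ
    rw [ft_opA, ← hg, pow_split hs, nsq_deriv, nsq_deriv, nsq_apply, ← Complex.normSq_eq_norm_sq]
    simp only [Complex.normSq_apply, Complex.mul_re, Complex.mul_im, Complex.add_re,
      Complex.add_im, Complex.sub_re, Complex.sub_im, Complex.neg_re, Complex.neg_im,
      Complex.ofReal_re, Complex.ofReal_im, Complex.conj_re, Complex.conj_im, Complex.re_ofNat,
      Complex.im_ofNat]
    ring
  simp only [e3]
  have k1 := hK.const_mul (-(1 / ε))
  have k2 := hJ.const_mul (-(2 * μ))
  have k3 := (b0.add b1).const_mul (-(μ / 2))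
  have q1 := integral_add (k1.add k2) k3
  simp only [Pi.add_apply] at q1
  rw [q1, integral_add k1 k2, integral_const_mul, integral_const_mul,
    integral_const_mul, integral_add b0 b1, c0, c1]
  have e4 : (∫ x : R2, wd s (basis2 0) x * nsq g x) + ∫ x : R2, wd s (basis2 1) x * nsq g x =
      (2 + 2 * s) * ∫ ξ : R2, ‖ξ‖ ^ (2 * s) * nsq g ξ := by
    rw [← integral_add a0 a1, ← integral_const_mul]
    refine integral_congr_ae (Filter.Eventually.of_forall fun ξ => ?_)
    simp only []
    rw [← add_mul, wd_sum hs]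
    ring
  linear_combination (μ / 2) * e4

end
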